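/- arXiv:1512.07959 — 6 statements merged into one kernel-verified Lean document; each statement's English description precedes it below -/
import Mathlib

section
/- For every n ≥ 1, the set 𝒲ₙ(2) is a subgroup of SL_n(ℤ): it contains the identity matrix, is closed under matrix multiplication, and is closed under taking inverses. -/
/-- The set 𝒲ₙ(2) of matrices `A ∈ SL_n(ℤ)` such that the pre-dot product
(entrywise product) of any two distinct rows of `A` lies in `(2ℤ)ⁿ`. -/
def Wn (n : ℕ) : Set (Matrix.SpecialLinearGroup (Fin n) ℤ) :=
  {A | ∀ i j : Fin n, i ≠ j → ∀ s : Fin n, (2 : ℤ) ∣ A.1 i s * A.1 j s}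

theorem Wn_one_mem (n : ℕ) : (1 : Matrix.SpecialLinearGroup (Fin n) ℤ) ∈ Wn n := by
  intro i j hij s
  by_cases his : i = s
  · have hjs : j ≠ s := fun h => hij (his.trans h.symm)
    simp [Matrix.one_apply, hjs]
  · simp [Matrix.one_apply, his]

theorem Wn_mul_mem {n : ℕ} {A B : Matrix.SpecialLinearGroup (Fin n) ℤ}
    (hA : A ∈ Wn n) (hB : B ∈ Wn n) : A * B ∈ Wn n := by
  intro i j hij s
  change (2 : ℤ) ∣ (A.1 * B.1) i s * (A.1 * B.1) j s
  rw [Matrix.mul_apply, Matrix.mul_apply, Finset.sum_mul_sum]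
  refine Finset.dvd_sum fun k _ => Finset.dvd_sum fun l _ => ?_
  rw [mul_mul_mul_comm]
  by_cases hkl : k = l
  · subst hkl
    exact (hA i j hij k).mul_right _
  · exact (hB k l hkl s).mul_left _

theorem Wn_pow_mem {n : ℕ} {A : Matrix.SpecialLinearGroup (Fin n) ℤ}
    (hA : A ∈ Wn n) (k : ℕ) : A ^ k ∈ Wn n := by
  induction k with
  | zero => simpa using Wn_one_mem n
  | succ k ih => simpa only [pow_succ] using Wn_mul_mem ih hA

/-- Membership in `𝒲ₙ(2)` depends only on the reduction modulo `2`. -/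
theorem mem_Wn_iff_map {n : ℕ} (A : Matrix.SpecialLinearGroup (Fin n) ℤ) :
    A ∈ Wn n ↔ ∀ i j : Fin n, i ≠ j → ∀ s : Fin n,
      (Matrix.SpecialLinearGroup.map (Int.castRingHom (ZMod 2)) A).1 i s *
        (Matrix.SpecialLinearGroup.map (Int.castRingHom (ZMod 2)) A).1 j s = 0 := by
  refine forall₂_congr fun i j => forall₂_congr fun _ s => ?_
  change _ ↔ ((A.1 i s : ℤ) : ZMod 2) * ((A.1 j s : ℤ) : ZMod 2) = 0
  rw [← Int.cast_mul, ZMod.intCast_zmod_eq_zero_iff_dvd, Nat.cast_ofNat]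

/-- Since `SL_n(ℤ/2)` is finite, `A⁻¹` is congruent modulo `2` to a power of `A`. -/
theorem Wn_inv_mem {n : ℕ} {A : Matrix.SpecialLinearGroup (Fin n) ℤ}
    (hA : A ∈ Wn n) : A⁻¹ ∈ Wn n := by
  set f := Matrix.SpecialLinearGroup.map (n := Fin n) (Int.castRingHom (ZMod 2)) with hf
  have : Finite (Matrix.SpecialLinearGroup (Fin n) (ZMod 2)) := Subtype.finite
  obtain ⟨k, hk⟩ : (f A)⁻¹ ∈ Submonoid.powers (f A) :=
    mem_powers_iff_mem_zpowers.2 (inv_mem (Subgroup.mem_zpowers _))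
  have hmap : f A⁻¹ = f (A ^ k) := by
    rw [map_inv, map_pow]
    exact hk.symm
  rw [mem_Wn_iff_map, ← hf, hmap]
  exact (mem_Wn_iff_map _).1 (Wn_pow_mem hA k)

/-- For every `n ≥ 1`, the set `𝒲ₙ(2)` is a subgroup of `SL_n(ℤ)`: it contains the
identity matrix, is closed under matrix multiplication, and is closed under inverses. -/
theorem Wn_one_mem_mul_mem_inv_mem (n : ℕ) (hn : 1 ≤ n) :
    (1 : Matrix.SpecialLinearGroup (Fin n) ℤ) ∈ Wn n ∧
    (∀ A B : Matrix.SpecialLinearGroup (Fin n) ℤ, A ∈ Wn n → B ∈ Wn n → A * B ∈ Wn n) ∧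
    (∀ A : Matrix.SpecialLinearGroup (Fin n) ℤ, A ∈ Wn n → A⁻¹ ∈ Wn n) := by
  exact ⟨Wn_one_mem n, fun _ _ => Wn_mul_mem, fun _ => Wn_inv_mem⟩
end

section
/- A matrix A ∈ SL_n(ℤ) belongs to 𝒲ₙ(2) if and only if A has exactly one odd entry in each row and exactly one odd entry in each column, i.e., if and only if the reduction of A modulo 2 is a permutation matrix over ℤ/2ℤ. -/
/-- An integer matrix with odd determinant has an odd transversal. -/
theorem Matrix.exists_perm_forall_not_two_dvd {m : Type*} [Fintype m] [DecidableEq m]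
    {M : Matrix m m ℤ} (hM : ¬ (2 : ℤ) ∣ M.det) :
    ∃ σ : Equiv.Perm m, ∀ i, ¬ (2 : ℤ) ∣ M i (σ i) := by
  by_contra! h
  refine hM ?_
  rw [← Matrix.det_transpose, Matrix.det_apply']
  refine Finset.dvd_sum fun σ _ => ?_
  obtain ⟨i, hi⟩ := h σ
  exact ((hi.trans (Finset.dvd_prod_of_mem (fun i => M.transpose (σ i) i)
    (Finset.mem_univ i)))).mul_left _

theorem mem_Wn_iff_exists_perm {n : ℕ} {A : Matrix.SpecialLinearGroup (Fin n) ℤ} :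
    A ∈ Wn n ↔ ∃ σ : Equiv.Perm (Fin n), ∀ i j, ¬ (2 : ℤ) ∣ A.1 i j ↔ σ i = j := by
  constructor
  · intro h
    have hdet : ¬ (2 : ℤ) ∣ A.1.det := by rw [A.2]; decide
    obtain ⟨σ, hσ⟩ := Matrix.exists_perm_forall_not_two_dvd hdet
    refine ⟨σ, fun i j => ⟨fun hij => ?_, fun hij => hij ▸ hσ i⟩⟩
    by_contra hne
    have hodd := hσ (σ.symm j)
    rw [σ.apply_symm_apply] at hodd
    have hi : i ≠ σ.symm j := fun e => hne (by rw [e, σ.apply_symm_apply])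
    exact (Int.prime_two.dvd_or_dvd (h i _ hi j)).elim hij hodd
  · rintro ⟨σ, hσ⟩ i j hij s
    by_contra h
    have hi := (hσ i s).1 fun hd => h (hd.mul_right _)
    have hj := (hσ j s).1 fun hd => h (hd.mul_left _)
    exact hij (σ.injective (hi.trans hj.symm))

theorem map_intCast_eq_permMatrix_iff {m : Type*} [DecidableEq m] {M : Matrix m m ℤ}
    {σ : Equiv.Perm m} :
    M.map (Int.cast : ℤ → ZMod 2) = σ.permMatrix (ZMod 2) ↔
      ∀ i j, ¬ (2 : ℤ) ∣ M i j ↔ σ i = j := by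
  rw [← Matrix.ext_iff]
  refine forall₂_congr fun i j => ?_
  have hdvd : (2 : ℤ) ∣ M i j ↔ (M i j : ZMod 2) = 0 :=
    (ZMod.intCast_zmod_eq_zero_iff_dvd (M i j) 2).symm
  rw [Matrix.map_apply, Equiv.Perm.permMatrix, PEquiv.toMatrix_toPEquiv_eq,
    Matrix.submatrix_apply, Matrix.one_apply, id, hdvd]
  generalize (M i j : ZMod 2) = x
  by_cases h : σ i = j
  · simp only [h, if_true, iff_true]
    revert x; decide
  · simp only [h, if_false, iff_false, not_not]

/-- A matrix `A ∈ SL_n(ℤ)` belongs to `𝒲ₙ(2)` if and only if `A` has exactly one odd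
entry in each row and exactly one odd entry in each column, i.e. if and only if the
reduction of `A` modulo `2` is a permutation matrix over `ℤ/2ℤ`. -/
theorem mem_Wn_iff_permMatrix (n : ℕ) (A : Matrix.SpecialLinearGroup (Fin n) ℤ) :
    (A ∈ Wn n ↔ (∀ i : Fin n, ∃! j : Fin n, ¬ (2 : ℤ) ∣ A.1 i j) ∧
      (∀ j : Fin n, ∃! i : Fin n, ¬ (2 : ℤ) ∣ A.1 i j)) ∧
    (A ∈ Wn n ↔ ∃ σ : Equiv.Perm (Fin n),
      A.1.map (Int.cast : ℤ → ZMod 2) = σ.permMatrix (ZMod 2)) := by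
  refine ⟨⟨fun h => ?_, ?_⟩, ?_⟩
  · obtain ⟨σ, hσ⟩ := mem_Wn_iff_exists_perm.1 h
    simp only [hσ]
    exact ⟨fun i => ⟨σ i, rfl, fun _ hj => hj.symm⟩, fun j => σ.bijective.existsUnique j⟩
  · rintro ⟨-, hcol⟩ i j hij s
    by_contra h
    exact hij ((hcol s).unique (fun hd => h (hd.mul_right _)) fun hd => h (hd.mul_left _))
  · simp only [mem_Wn_iff_exists_perm, map_intCast_eq_permMatrix_iff]
end

section
/- For every n ≥ 1, the index of the principal congruence subgroup Γₙ(2) in the group 𝒲ₙ(2) equals n!. -/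
/-- The principal congruence subgroup `Γₙ(2)`, the kernel of the reduction
homomorphism `SL_n(ℤ) → SL_n(ℤ/2ℤ)`. -/
def Gamma (n : ℕ) : Subgroup (Matrix.SpecialLinearGroup (Fin n) ℤ) :=
  (Matrix.SpecialLinearGroup.map (n := Fin n) (Int.castRingHom (ZMod 2))).ker

/-- A permutation matrix with its first row multiplied by the sign of the permutation,
which makes its determinant equal to one. -/
def signedPermMatrix {m : ℕ} (σ : Equiv.Perm (Fin (m + 1))) :
    Matrix.SpecialLinearGroup (Fin (m + 1)) ℤ :=
  ⟨Matrix.diagonal (fun i => if i = 0 then (Equiv.Perm.sign σ : ℤ) else 1) *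
      σ.permMatrix ℤ, by
    rw [Matrix.det_mul, Matrix.det_diagonal, Matrix.det_permutation, Finset.prod_ite_eq']
    simp only [Finset.mem_univ, if_true, Int.cast_id]
    rw [← Units.val_mul, Int.units_mul_self, Units.val_one]⟩

theorem signedPermMatrix_apply {m : ℕ} (σ : Equiv.Perm (Fin (m + 1))) (i j : Fin (m + 1)) :
    (signedPermMatrix σ).1 i j =
      if σ i = j then (if i = 0 then (Equiv.Perm.sign σ : ℤ) else 1) else 0 := by
  simp [signedPermMatrix, Matrix.diagonal_mul, Equiv.Perm.permMatrix, PEquiv.toMatrix_apply,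
    eq_comm]

theorem signedPermMatrix_cast {m : ℕ} (σ : Equiv.Perm (Fin (m + 1))) (i j : Fin (m + 1)) :
    (((signedPermMatrix σ).1 i j : ℤ) : ZMod 2) = if σ i = j then 1 else 0 := by
  rw [signedPermMatrix_apply]
  rcases Int.units_eq_one_or (Equiv.Perm.sign σ) with h | h <;> rw [h] <;> split_ifs <;> rfl

theorem signedPermMatrix_mem_Wn {m : ℕ} (σ : Equiv.Perm (Fin (m + 1))) :
    signedPermMatrix σ ∈ Wn (m + 1) := by
  intro i j hij s
  rw [signedPermMatrix_apply, signedPermMatrix_apply]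
  by_cases hi : σ i = s
  · have hj : σ j ≠ s := fun hj => hij (σ.injective (hi.trans hj.symm))
    simp [hj]
  · simp [hi]

theorem mk_eq_mk_Gamma_iff {n : ℕ} (A B : Matrix.SpecialLinearGroup (Fin n) ℤ) :
    (QuotientGroup.mk A : Matrix.SpecialLinearGroup (Fin n) ℤ ⧸ Gamma n) = QuotientGroup.mk B ↔
      ∀ i j, ((A.1 i j : ℤ) : ZMod 2) = ((B.1 i j : ℤ) : ZMod 2) := by
  rw [QuotientGroup.eq, Gamma, MonoidHom.mem_ker, map_mul, map_inv, inv_mul_eq_one,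
    Matrix.SpecialLinearGroup.ext_iff]
  rfl

theorem exists_perm_of_mem_Wn {n : ℕ} {A : Matrix.SpecialLinearGroup (Fin n) ℤ}
    (hA : A ∈ Wn n) :
    ∃ σ : Equiv.Perm (Fin n), ∀ i j, ((A.1 i j : ℤ) : ZMod 2) = if σ i = j then 1 else 0 := by
  set B := Matrix.SpecialLinearGroup.map (n := Fin n) (Int.castRingHom (ZMod 2)) A with hB
  have hBA : ∀ i j, B.1 i j = ((A.1 i j : ℤ) : ZMod 2) := fun i j => rfl
  have hmul : ∀ i j, i ≠ j → ∀ s, B.1 i s * B.1 j s = 0 := by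
    intro i j hij s
    rw [hBA, hBA, ← Int.cast_mul]
    exact (ZMod.intCast_zmod_eq_zero_iff_dvd _ 2).2 (by exact_mod_cast hA i j hij s)
  have hrow : ∀ i, ∃ s, B.1 i s ≠ 0 := by
    intro i
    by_contra! h
    exact one_ne_zero (B.2.symm.trans (Matrix.det_eq_zero_of_row_eq_zero i h))
  have hcol : ∀ s, ∃ i, B.1 i s ≠ 0 := by
    intro s
    by_contra! h
    exact one_ne_zero (B.2.symm.trans (Matrix.det_eq_zero_of_column_eq_zero s h))
  choose τ hτ using hcol
  have huniq : ∀ i s, B.1 i s ≠ 0 → τ s = i := by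
    intro i s h
    by_contra hne
    exact mul_ne_zero (hτ s) h (hmul _ _ hne s)
  have hsurj : Function.Surjective τ := fun i => (hrow i).imp fun s hs => huniq i s hs
  have hbij : Function.Bijective τ := Finite.surjective_iff_bijective.1 hsurj
  refine ⟨(Equiv.ofBijective τ hbij).symm, fun i j => ?_⟩
  rw [← hBA]
  have hiff : (Equiv.ofBijective τ hbij).symm i = j ↔ τ j = i := by
    rw [Equiv.symm_apply_eq]
    exact eq_comm
  have hone : ∀ x : ZMod 2, x ≠ 0 → x = 1 := by decide
  split_ifs with h
  · rw [← hiff.1 h]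
    exact hone _ (hτ j)
  · by_contra hne
    exact h (hiff.2 (huniq i j hne))

/-- For every `n ≥ 1`, the index of `Γₙ(2)` in `𝒲ₙ(2)` equals `n!`; equivalently, the
set of cosets of `Γₙ(2)` represented by elements of `𝒲ₙ(2)` has cardinality `n!`. -/
theorem Gamma_index_in_Wn (n : ℕ) (hn : 1 ≤ n) :
    Nat.card ((QuotientGroup.mk '' Wn n :
      Set (Matrix.SpecialLinearGroup (Fin n) ℤ ⧸ Gamma n))) = Nat.factorial n := by
  obtain ⟨m, rfl⟩ : ∃ m, n = m + 1 := ⟨n - 1, by omega⟩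
  have himage : (QuotientGroup.mk '' Wn (m + 1) :
      Set (Matrix.SpecialLinearGroup (Fin (m + 1)) ℤ ⧸ Gamma (m + 1))) =
      Set.range fun σ => QuotientGroup.mk (signedPermMatrix σ) := by
    ext x
    constructor
    · rintro ⟨A, hA, rfl⟩
      obtain ⟨σ, hσ⟩ := exists_perm_of_mem_Wn hA
      refine ⟨σ, (mk_eq_mk_Gamma_iff _ _).2 fun i j => ?_⟩
      rw [hσ, signedPermMatrix_cast]
    · rintro ⟨σ, rfl⟩
      exact ⟨_, signedPermMatrix_mem_Wn σ, rfl⟩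
  have hinj : Function.Injective fun σ : Equiv.Perm (Fin (m + 1)) =>
      (QuotientGroup.mk (signedPermMatrix σ) :
        Matrix.SpecialLinearGroup (Fin (m + 1)) ℤ ⧸ Gamma (m + 1)) := by
    intro σ τ h
    ext1 i
    have hi := (mk_eq_mk_Gamma_iff _ _).1 h i (σ i)
    rw [signedPermMatrix_cast, signedPermMatrix_cast, if_pos rfl] at hi
    by_contra hne
    rw [if_neg (Ne.symm hne)] at hi
    exact one_ne_zero hi
  rw [himage, Nat.card_range_of_injective hinj, Nat.card_perm, Nat.card_fin]
end

section
/- Every matrix A ∈ 𝒲ₙ(2) can be written as A = P_σ B or as A = τ P_σ B for some even permutation σ of {1,…,n} and some B ∈ Γₙ(2); i.e., the matrices {P_σ : σ ∈ Aₙ} ∪ {τ P_σ : σ ∈ Aₙ} form a complete set of coset representatives for Γₙ(2) in 𝒲ₙ(2), where Aₙ is the alternating group. -/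
/-- The block-diagonal matrix `τ` whose upper-left `2 × 2` block is `((0,-1),(1,0))`
and whose lower-right block is the identity matrix `I_{n-2}`. -/
def tauMat (n : ℕ) : Matrix (Fin n) (Fin n) ℤ := fun i j =>
  if (i : ℕ) = 0 then (if (j : ℕ) = 1 then -1 else 0)
  else if (i : ℕ) = 1 then (if (j : ℕ) = 0 then 1 else 0)
  else if i = j then 1 else 0

open Matrix Equiv

theorem permMatrix_apply_eq_ite {n : ℕ} {R : Type*} [Zero R] [One R] (σ : Perm (Fin n))
    (i j : Fin n) : σ.permMatrix R i j = if σ i = j then 1 else 0 := by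
  simp [Perm.permMatrix, PEquiv.toMatrix_apply, eq_comm]

theorem permMatrix_injective {n : ℕ} {R : Type*} [Zero R] [One R] [NeZero (1 : R)] :
    Function.Injective (fun σ : Perm (Fin n) => σ.permMatrix R) := by
  intro σ σ' h
  ext i : 1
  have h1 := congrFun (congrFun h i) (σ' i)
  simpa [permMatrix_apply_eq_ite] using h1

theorem permMatrix_map_intCast {n : ℕ} (R : Type*) [Ring R] (σ : Perm (Fin n)) :
    (σ.permMatrix ℤ).map (Int.castRingHom R) = σ.permMatrix R := by
  ext i j
  simp only [Matrix.map_apply, permMatrix_apply_eq_ite]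
  split_ifs <;> simp

/-- The transposition of the first two indices. -/
def swapFirstTwo {n : ℕ} (hn : 2 ≤ n) : Perm (Fin n) :=
  swap ⟨0, by omega⟩ ⟨1, by omega⟩

theorem sign_swapFirstTwo {n : ℕ} (hn : 2 ≤ n) : Perm.sign (swapFirstTwo hn) = -1 :=
  Perm.sign_swap (by simp [Fin.ext_iff])

theorem tauMat_eq_diagonal_mul {n : ℕ} (hn : 2 ≤ n) :
    tauMat n = diagonal (fun i : Fin n => if i = ⟨0, by omega⟩ then -1 else 1) *
      (swapFirstTwo hn).permMatrix ℤ := by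
  ext i j
  rw [diagonal_mul, permMatrix_apply_eq_ite, tauMat, swapFirstTwo, swap_apply_def]
  simp only [Fin.ext_iff]
  grind

theorem det_tauMat {n : ℕ} (hn : 2 ≤ n) : (tauMat n).det = 1 := by
  rw [tauMat_eq_diagonal_mul hn, det_mul, det_diagonal, det_permutation, sign_swapFirstTwo,
    Finset.prod_ite_eq']
  simp

theorem tauMat_map_zmod_two {n : ℕ} (hn : 2 ≤ n) :
    (tauMat n).map (Int.castRingHom (ZMod 2)) = (swapFirstTwo hn).permMatrix (ZMod 2) := by
  have h : (-1 : ZMod 2) = 1 := by decide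
  rw [tauMat_eq_diagonal_mul hn, Matrix.map_mul, permMatrix_map_intCast,
    diagonal_map (map_zero _)]
  have hdiag : (fun m : Fin n => Int.castRingHom (ZMod 2) (if m = ⟨0, by omega⟩ then -1 else 1)) =
      fun _ => 1 := by
    ext i
    split_ifs <;> simp [h]
  rw [hdiag, diagonal_one, one_mul]

theorem mem_Gamma_iff {n : ℕ} (B : SpecialLinearGroup (Fin n) ℤ) :
    B ∈ Gamma n ↔ B.1.map (Int.castRingHom (ZMod 2)) = 1 := by
  rw [Gamma, MonoidHom.mem_ker]
  exact ⟨fun h => congrArg Subtype.val h, fun h => Subtype.ext h⟩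

/-- Two matrices in `SL_n(ℤ)` with the same reduction mod `2` differ by an element of `Γₙ(2)`. -/
theorem exists_mem_Gamma_of_map_eq {n : ℕ} (A : SpecialLinearGroup (Fin n) ℤ)
    (X : Matrix (Fin n) (Fin n) ℤ) (hX : X.det = 1)
    (h : A.1.map (Int.castRingHom (ZMod 2)) = X.map (Int.castRingHom (ZMod 2))) :
    ∃ B ∈ Gamma n, A.1 = X * B.1 := by
  let Y : SpecialLinearGroup (Fin n) ℤ := ⟨X, hX⟩
  refine ⟨Y⁻¹ * A, ?_, ?_⟩
  · have h' : SpecialLinearGroup.map (Int.castRingHom (ZMod 2)) A =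
        SpecialLinearGroup.map (Int.castRingHom (ZMod 2)) Y := Subtype.ext h
    rw [Gamma, MonoidHom.mem_ker, map_mul, map_inv, h', inv_mul_cancel]
  · exact congrArg Subtype.val (mul_inv_cancel_left Y A).symm

/-- An invertible matrix over `ℤ/2ℤ` whose distinct rows have disjoint supports is a
permutation matrix. -/
theorem exists_permMatrix_eq_of_mul_eq_zero {n : ℕ} (M : Matrix (Fin n) (Fin n) (ZMod 2))
    (hdet : M.det ≠ 0) (hM : ∀ i j, i ≠ j → ∀ s, M i s * M j s = 0) :
    ∃ σ : Perm (Fin n), M = σ.permMatrix (ZMod 2) := by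
  have hone : ∀ x : ZMod 2, x ≠ 0 → x = 1 := by decide
  have hex : ∀ s, ∃ i, M i s ≠ 0 := by
    intro s
    by_contra! hs
    exact hdet (det_eq_zero_of_column_eq_zero s hs)
  choose f hf using hex
  have hentry : ∀ i s, M i s = if f s = i then 1 else 0 := by
    intro i s
    split_ifs with his
    · exact hone _ (his ▸ hf s)
    · exact (mul_eq_zero.mp (hM _ _ his s)).resolve_left (hf s)
  have hinj : Function.Injective f := by
    intro s t hst
    by_contra hne
    exact hdet (det_zero_of_column_eq hne fun i => by rw [hentry, hentry, hst])
  let e : Perm (Fin n) := Equiv.ofBijective f (Finite.injective_iff_bijective.mp hinj)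
  refine ⟨e⁻¹, ?_⟩
  ext i s
  rw [hentry, permMatrix_apply_eq_ite]
  refine if_congr ?_ rfl rfl
  rw [Perm.inv_eq_iff_eq, eq_comm]
  rfl

theorem exists_permMatrix_eq_map_of_mem_Wn {n : ℕ} {A : SpecialLinearGroup (Fin n) ℤ}
    (hA : A ∈ Wn n) :
    ∃ σ : Perm (Fin n), A.1.map (Int.castRingHom (ZMod 2)) = σ.permMatrix (ZMod 2) := by
  apply exists_permMatrix_eq_of_mul_eq_zero
  · have hd : (A.1.map (Int.castRingHom (ZMod 2))).det = 1 :=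
      (SpecialLinearGroup.map (Int.castRingHom (ZMod 2)) A).2
    rw [hd]
    exact one_ne_zero
  · intro i j hij s
    rw [Matrix.map_apply, Matrix.map_apply, ← map_mul]
    exact (ZMod.intCast_zmod_eq_zero_iff_dvd _ 2).mpr (hA i j hij s)

theorem cond_tauMat_mul_permMatrix_map {n : ℕ} (hn : 2 ≤ n) (b : Bool) (σ : Perm (Fin n)) :
    (cond b (tauMat n) 1 * σ.permMatrix ℤ).map (Int.castRingHom (ZMod 2)) =
      (σ * cond b (swapFirstTwo hn) 1).permMatrix (ZMod 2) := by
  rw [Matrix.map_mul, permMatrix_map_intCast, permMatrix_mul]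
  cases b
  · simp
  · rw [cond_true, cond_true, tauMat_map_zmod_two hn]

/-- Every `A ∈ 𝒲ₙ(2)` can be written as `A = P_σ B` or `A = τ P_σ B` with `σ` an even
permutation and `B ∈ Γₙ(2)`; moreover the matrices `{P_σ : σ ∈ Aₙ} ∪ {τ P_σ : σ ∈ Aₙ}`
represent pairwise distinct cosets, so they form a complete set of coset representatives
for `Γₙ(2)` in `𝒲ₙ(2)`. -/
theorem Wn_coset_representatives (n : ℕ) (hn : 2 ≤ n) :
    (∀ A ∈ Wn n, ∃ σ : Equiv.Perm (Fin n), Equiv.Perm.sign σ = 1 ∧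
      ∃ B ∈ Gamma n,
        (A.1 = σ.permMatrix ℤ * B.1 ∨ A.1 = tauMat n * σ.permMatrix ℤ * B.1)) ∧
    (∀ σ σ' : Equiv.Perm (Fin n), Equiv.Perm.sign σ = 1 → Equiv.Perm.sign σ' = 1 →
      ∀ b b' : Bool, ∀ B : Matrix.SpecialLinearGroup (Fin n) ℤ, B ∈ Gamma n →
        (cond b (tauMat n) 1) * σ.permMatrix ℤ * B.1 =
          (cond b' (tauMat n) 1) * σ'.permMatrix ℤ →
        b = b' ∧ σ = σ') := by
  have hswap : swapFirstTwo hn * swapFirstTwo hn = 1 := swap_mul_self _ _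
  refine ⟨fun A hA => ?_, fun σ σ' hσ hσ' b b' B hB h => ?_⟩
  · obtain ⟨π, hπ⟩ := exists_permMatrix_eq_map_of_mem_Wn hA
    rcases Int.units_eq_one_or (Perm.sign π) with hs | hs
    · obtain ⟨B, hB, h⟩ := exists_mem_Gamma_of_map_eq A (π.permMatrix ℤ)
        (by rw [det_permutation, hs]; rfl) (by rw [hπ, permMatrix_map_intCast])
      exact ⟨π, hs, B, hB, Or.inl h⟩
    · have hs' : Perm.sign (π * swapFirstTwo hn) = 1 := by
        rw [map_mul, hs, sign_swapFirstTwo]; rfl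
      obtain ⟨B, hB, h⟩ := exists_mem_Gamma_of_map_eq A
        (tauMat n * (π * swapFirstTwo hn).permMatrix ℤ)
        (by rw [det_mul, det_tauMat hn, det_permutation, hs']; rfl)
        (by
          rw [hπ]
          have key := cond_tauMat_mul_permMatrix_map hn true (π * swapFirstTwo hn)
          rw [cond_true, cond_true, mul_assoc, hswap, mul_one] at key
          exact key.symm)
      exact ⟨π * swapFirstTwo hn, hs', B, hB, Or.inr h⟩
  · have h2 := congrArg (fun M => M.map (Int.castRingHom (ZMod 2))) h
    beta_reduce at h2
    rw [Matrix.map_mul, (mem_Gamma_iff B).mp hB, mul_one, cond_tauMat_mul_permMatrix_map hn,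
      cond_tauMat_mul_permMatrix_map hn] at h2
    have h3 := permMatrix_injective h2
    have h4 := congrArg Perm.sign h3
    rw [map_mul, map_mul, hσ, hσ', one_mul, one_mul] at h4
    have hb : b = b' := by
      cases b <;> cases b' <;> simp [sign_swapFirstTwo] at h4 ⊢
    subst hb
    exact ⟨rfl, mul_right_cancel h3⟩
end

section
/- The principal congruence subgroup Γ₂(2) of SL₂(ℤ) is generated by the three matrices E₁₂² = ((1,2),(0,1)), E₂₁² = ((1,0),(2,1)), and −I₂. -/
/-- The principal congruence subgroup `Γ₂(2)`, the kernel of the reduction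
homomorphism `SL₂(ℤ) → SL₂(ℤ/2ℤ)`. -/
def Gamma2 : Subgroup (Matrix.SpecialLinearGroup (Fin 2) ℤ) :=
  (Matrix.SpecialLinearGroup.map (n := Fin 2) (Int.castRingHom (ZMod 2))).ker

/-- `E₁₂² = ((1,2),(0,1))` as an element of `SL₂(ℤ)`. -/
def E12sq : Matrix.SpecialLinearGroup (Fin 2) ℤ :=
  ⟨!![1, 2; 0, 1], by norm_num [Matrix.det_fin_two_of]⟩

/-- `E₂₁² = ((1,0),(2,1))` as an element of `SL₂(ℤ)`. -/
def E21sq : Matrix.SpecialLinearGroup (Fin 2) ℤ :=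
  ⟨!![1, 0; 2, 1], by norm_num [Matrix.det_fin_two_of]⟩

/-- `-I₂` as an element of `SL₂(ℤ)`. -/
def negI2 : Matrix.SpecialLinearGroup (Fin 2) ℤ :=
  ⟨!![-1, 0; 0, -1], by norm_num [Matrix.det_fin_two_of]⟩

theorem mem_Gamma2_iff {g : Matrix.SpecialLinearGroup (Fin 2) ℤ} :
    g ∈ Gamma2 ↔ Odd (g 0 0) ∧ Even (g 0 1) ∧ Even (g 1 0) ∧ Odd (g 1 1) := by
  have h : g ∈ Gamma2 ↔ g ∈ CongruenceSubgroup.Gamma 2 := Iff.rfl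
  rw [h, CongruenceSubgroup.Gamma_mem]
  have ho (x : ℤ) : (x : ZMod 2) = 1 ↔ Odd x := by
    rw [← Int.cast_one, ZMod.intCast_eq_intCast_iff, Int.odd_iff]; rfl
  have he (x : ℤ) : (x : ZMod 2) = 0 ↔ Even x := by
    rw [ZMod.intCast_zmod_eq_zero_iff_dvd, even_iff_two_dvd]; rfl
  simp only [ho, he]

theorem E12sq_mem_Gamma2 : E12sq ∈ Gamma2 := by
  rw [mem_Gamma2_iff]; simp [E12sq]

theorem E21sq_mem_Gamma2 : E21sq ∈ Gamma2 := by
  rw [mem_Gamma2_iff]; simp [E21sq]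

theorem negI2_mem_Gamma2 : negI2 ∈ Gamma2 := by
  rw [mem_Gamma2_iff]; simp [negI2]

theorem E12sq_zpow_coe (k : ℤ) :
    ((E12sq ^ k : Matrix.SpecialLinearGroup (Fin 2) ℤ) : Matrix (Fin 2) (Fin 2) ℤ) =
      !![1, 2 * k; 0, 1] := by
  have h : E12sq = ModularGroup.T ^ (2 : ℤ) := by
    ext i j
    rw [ModularGroup.coe_T_zpow]
    rfl
  rw [h, ← zpow_mul, ModularGroup.coe_T_zpow]

theorem negI2_mul_coe (g : Matrix.SpecialLinearGroup (Fin 2) ℤ) (i j : Fin 2) :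
    (negI2 * g) i j = -g i j := by
  rw [Matrix.SpecialLinearGroup.coe_mul, Matrix.mul_apply, Fin.sum_univ_two]
  fin_cases i <;> simp [negI2]

/-- An upper triangular element of `Γ₂(2)` is, up to sign, a power of `E₁₂²`. -/
theorem mem_closure_of_lower_left_eq_zero {g : Matrix.SpecialLinearGroup (Fin 2) ℤ}
    (hg : g ∈ Gamma2) (hc : g 1 0 = 0) :
    g ∈ Subgroup.closure {E12sq, E21sq, negI2} := by
  have hE : E12sq ∈ Subgroup.closure {E12sq, E21sq, negI2} :=
    Subgroup.subset_closure (by simp)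
  have hN : negI2 ∈ Subgroup.closure {E12sq, E21sq, negI2} :=
    Subgroup.subset_closure (by simp)
  obtain ⟨k, hk⟩ := even_iff_two_dvd.mp (mem_Gamma2_iff.mp hg).2.1
  have hdet := g.det_coe
  rw [Matrix.det_fin_two, hc, mul_zero, sub_zero] at hdet
  rcases Int.mul_eq_one_iff_eq_one_or_neg_one.mp hdet with ⟨ha, hd⟩ | ⟨ha, hd⟩
  · have h : g = E12sq ^ k := by
      ext i j
      rw [E12sq_zpow_coe]
      fin_cases i <;> fin_cases j <;> simp [*]
    exact h ▸ zpow_mem hE k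
  · have h : negI2 * g = E12sq ^ (-k) := by
      ext i j
      rw [negI2_mul_coe, E12sq_zpow_coe]
      fin_cases i <;> fin_cases j <;> simp [*]
    rw [← Subgroup.mul_mem_cancel_left _ hN, h]
    exact zpow_mem hE _

/-- One step of the Euclidean algorithm on the first column of an element of `Γ₂(2)`. -/
theorem exists_mul_natAbs_lt {g : Matrix.SpecialLinearGroup (Fin 2) ℤ}
    (hg : g ∈ Gamma2) (hc : g 1 0 ≠ 0) :
    ∃ h ∈ ({E12sq, E12sq⁻¹, E21sq, E21sq⁻¹} : Set (Matrix.SpecialLinearGroup (Fin 2) ℤ)),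
      ((h * g) 0 0).natAbs + ((h * g) 1 0).natAbs < (g 0 0).natAbs + (g 1 0).natAbs := by
  obtain ⟨⟨m, hm⟩, -, ⟨n, hn⟩, -⟩ := mem_Gamma2_iff.mp hg
  have hE (k : ℤ) : (E12sq ^ k * g) 0 0 = g 0 0 + 2 * k * g 1 0 ∧
      (E12sq ^ k * g) 1 0 = g 1 0 := by
    simp [Matrix.SpecialLinearGroup.coe_mul, Matrix.mul_apply, Fin.sum_univ_two, E12sq_zpow_coe]
  have hF : (E21sq * g) 0 0 = g 0 0 ∧ (E21sq * g) 1 0 = 2 * g 0 0 + g 1 0 := by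
    rw [Matrix.SpecialLinearGroup.coe_mul]
    simp [Matrix.mul_apply, Fin.sum_univ_two, E21sq]
  have hF' : (E21sq⁻¹ * g) 0 0 = g 0 0 ∧ (E21sq⁻¹ * g) 1 0 = -2 * g 0 0 + g 1 0 := by
    rw [Matrix.SpecialLinearGroup.coe_mul, Matrix.SpecialLinearGroup.coe_inv]
    simp [Matrix.mul_apply, Fin.sum_univ_two, E21sq]
  simp only [Set.mem_insert_iff, Set.mem_singleton_iff, exists_eq_or_imp, exists_eq_left]
  have h₁ := hE 1
  have h₂ := hE (-1)
  rw [zpow_one] at h₁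
  rw [zpow_neg_one] at h₂
  omega

theorem Gamma2_le_closure : Gamma2 ≤ Subgroup.closure {E12sq, E21sq, negI2} := by
  intro g hg
  induction hs : (g 0 0).natAbs + (g 1 0).natAbs using Nat.strong_induction_on generalizing g with
  | _ s ih =>
    by_cases hc : g 1 0 = 0
    · exact mem_closure_of_lower_left_eq_zero hg hc
    obtain ⟨h, hh, hlt⟩ := exists_mul_natAbs_lt hg hc
    have h_mem {K : Subgroup (Matrix.SpecialLinearGroup (Fin 2) ℤ)}
        (h₁ : E12sq ∈ K) (h₂ : E21sq ∈ K) : h ∈ K := by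
      rcases hh with rfl | rfl | rfl | rfl
      exacts [h₁, inv_mem h₁, h₂, inv_mem h₂]
    rw [← Subgroup.mul_mem_cancel_left _
      (h_mem (Subgroup.subset_closure (by simp)) (Subgroup.subset_closure (by simp)))]
    exact ih _ (hs ▸ hlt) (mul_mem (h_mem E12sq_mem_Gamma2 E21sq_mem_Gamma2) hg) rfl

/-- The principal congruence subgroup `Γ₂(2)` of `SL₂(ℤ)` is generated by the three
matrices `E₁₂² = ((1,2),(0,1))`, `E₂₁² = ((1,0),(2,1))` and `-I₂`. -/
theorem Gamma2_eq_closure :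
    Gamma2 = Subgroup.closure {E12sq, E21sq, negI2} := by
  refine le_antisymm Gamma2_le_closure ((Subgroup.closure_le _).mpr ?_)
  rintro _ (rfl | rfl | rfl)
  exacts [E12sq_mem_Gamma2, E21sq_mem_Gamma2, negI2_mem_Gamma2]
end

section
/- In the quaternions, let a = √3 and let i, j, k denote the standard unit quaternions. Then the map P : (x₁, x₂) ↦ (x₁·x₂⁻¹, x₁⁻¹·x₂²) on pairs of unit quaternions satisfies P(−i, −1) = (i, i) and P(½(i + a·k), ½(1 + a·j)) = (i, i); in particular P is not injective on the unit quaternions, even though both arguments (−i, −1) and (½(i + a·k), ½(1 + a·j)) are pairs of quaternions of norm 1. -/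
theorem Quaternion.norm_eq_one_of_sq_sum {q : Quaternion ℝ}
    (h : q.re ^ 2 + q.imI ^ 2 + q.imJ ^ 2 + q.imK ^ 2 = 1) : ‖q‖ = 1 := by
  rw [← Quaternion.normSq_def', Quaternion.normSq_eq_norm_mul_self, ← sq] at h
  exact (pow_eq_one_iff_of_nonneg (norm_nonneg q) two_ne_zero).mp h

theorem mul_inv_pair_eq_of_mul_eq {D : Type*} [DivisionRing D] {x y z w : D}
    (hx : x ≠ 0) (hy : y ≠ 0) (hz : x = z * y) (hw : y ^ 2 = x * w) :
    (x * y⁻¹, x⁻¹ * y ^ 2) = (z, w) := by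
  rw [Prod.mk.injEq, mul_inv_eq_iff_eq_mul₀ hy, inv_mul_eq_iff_eq_mul₀ hx]
  exact ⟨hz, hw⟩

/-- In the quaternions, with `a = √3` and `i, j, k` the standard unit quaternions, the map
`P : (x₁, x₂) ↦ (x₁ x₂⁻¹, x₁⁻¹ x₂²)` (corresponding to the matrix `((1,-1),(-1,2))`)
sends both `(-i, -1)` and `(½(i + a·k), ½(1 + a·j))` — two distinct pairs of unit
quaternions — to `(i, i)`; in particular `P` is not injective on unit quaternions. -/
theorem quaternion_map_not_injective :
    let i : Quaternion ℝ := ⟨0, 1, 0, 0⟩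
    let j : Quaternion ℝ := ⟨0, 0, 1, 0⟩
    let k : Quaternion ℝ := ⟨0, 0, 0, 1⟩
    let a : ℝ := Real.sqrt 3
    let P : Quaternion ℝ × Quaternion ℝ → Quaternion ℝ × Quaternion ℝ :=
      fun p => (p.1 * p.2⁻¹, p.1⁻¹ * p.2 ^ 2)
    let x : Quaternion ℝ := -i
    let y : Quaternion ℝ := -1
    let u : Quaternion ℝ := (2⁻¹ : ℝ) • (i + a • k)
    let v : Quaternion ℝ := (2⁻¹ : ℝ) • (1 + a • j)
    ‖x‖ = 1 ∧ ‖y‖ = 1 ∧ ‖u‖ = 1 ∧ ‖v‖ = 1 ∧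
    P (x, y) = (i, i) ∧ P (u, v) = (i, i) ∧ (x, y) ≠ (u, v) := by
  intro i j k a P x y u v
  have ha : a ^ 2 = 3 := Real.sq_sqrt (by norm_num)
  have h1 : (1 : Quaternion ℝ).re = 1 ∧ (1 : Quaternion ℝ).imI = 0 ∧
      (1 : Quaternion ℝ).imJ = 0 ∧ (1 : Quaternion ℝ).imK = 0 := ⟨rfl, rfl, rfl, rfl⟩
  have hi : i.re = 0 ∧ i.imI = 1 ∧ i.imJ = 0 ∧ i.imK = 0 := ⟨rfl, rfl, rfl, rfl⟩
  have hj : j.re = 0 ∧ j.imI = 0 ∧ j.imJ = 1 ∧ j.imK = 0 := ⟨rfl, rfl, rfl, rfl⟩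
  have hk : k.re = 0 ∧ k.imI = 0 ∧ k.imJ = 0 ∧ k.imK = 1 := ⟨rfl, rfl, rfl, rfl⟩
  have hx : ‖x‖ = 1 := Quaternion.norm_eq_one_of_sq_sum (by simp [x, hi])
  have hy : ‖y‖ = 1 := by simp [y]
  have hu : ‖u‖ = 1 := Quaternion.norm_eq_one_of_sq_sum (by
    simp [u, hi, hk]
    linear_combination ha / 4)
  have hv : ‖v‖ = 1 := Quaternion.norm_eq_one_of_sq_sum (by
    simp [v, h1, hj]
    linear_combination ha / 4)
  have ne_zero {q : Quaternion ℝ} (hq : ‖q‖ = 1) : q ≠ 0 := norm_ne_zero_iff.mp (by simp [hq])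
  refine ⟨hx, hy, hu, hv, mul_inv_pair_eq_of_mul_eq (ne_zero hx) (ne_zero hy) ?_ ?_,
    mul_inv_pair_eq_of_mul_eq (ne_zero hu) (ne_zero hv) ?_ ?_, fun h => ?_⟩
  · simp [x, y]
  · ext <;> simp [x, y, h1, hi]
  · ext <;> simp [u, v, h1, hi, hj, hk]
  · rw [sq]
    ext <;> simp [u, v, h1, hi, hj, hk] <;> grind
  · have hre := congrArg (fun p => p.2.re) h
    norm_num [y, v, h1, hj] at hre
end
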